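/- Under the assumptions of the variational-posterior concentration theorem, and assuming that for every ε > 0 the variational posterior mass Q̂({θ ∈ Θ : d_H²(P_θ^{(n)}, P⋆^{(n)}) ≥ ε}) → 0 in P₀-probability (which holds by that theorem when the divergence d is taken as the squared Hellinger distance between the associated predictives), the total variation distance between the Gibbs variational predictive and the optimal predictive converges to zero in P₀-probability: d_TV(P_Q^{(n)}, P⋆^{(n)}) → 0. (First claim of the paper's Theorem 2: merging of the GVP with the optimal predictive.) -/

import Mathlib

open MeasureTheory Filter Topology

/-- Squared Hellinger distance between `P` and `Q`, computed through their densities with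
respect to the common dominating measure `μ`:
`d_H²(P,Q) = ∫ (√(dP/dμ) − √(dQ/dμ))² dμ`. -/
noncomputable def hellingerSq {𝒳 : Type*} [MeasurableSpace 𝒳]
    (μ P Q : Measure 𝒳) : ℝ :=
  ∫ x, (Real.sqrt ((P.rnDeriv μ x).toReal) - Real.sqrt ((Q.rnDeriv μ x).toReal)) ^ 2 ∂μ

/-- Total variation distance between two measures: `sup_A |P(A) − Q(A)|`. -/
noncomputable def dTV {𝒳 : Type*} [MeasurableSpace 𝒳] (P Q : Measure 𝒳) : ℝ :=
  ⨆ A : Set 𝒳, |(P A).toReal - (Q A).toReal|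

/-- A bound on `d_H²` controls the difference of the probabilities of any event. -/
lemma abs_measureReal_sub_le_of_hellingerSq_le {𝒳 : Type*} [MeasurableSpace 𝒳]
    (μ P Q : Measure 𝒳) [SigmaFinite μ] [IsProbabilityMeasure P] [IsProbabilityMeasure Q]
    (hP : P ≪ μ) (hQ : Q ≪ μ) {t : ℝ} (ht : 0 < t) (hH : hellingerSq μ P Q ≤ t ^ 2)
    (B : Set 𝒳) : |P.real B - Q.real B| ≤ 3 * t := by
  set p : 𝒳 → ℝ := fun x => (P.rnDeriv μ x).toReal with hp
  set q : 𝒳 → ℝ := fun x => (Q.rnDeriv μ x).toReal with hq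
  have hpi : Integrable p μ := Measure.integrable_toReal_rnDeriv
  have hqi : Integrable q μ := Measure.integrable_toReal_rnDeriv
  have hp0 : ∀ x, 0 ≤ p x := fun x => ENNReal.toReal_nonneg
  have hq0 : ∀ x, 0 ≤ q x := fun x => ENNReal.toReal_nonneg
  have hp1 : ∫ x, p x ∂μ = 1 := by
    rw [hp, Measure.integral_toReal_rnDeriv hP]; simp
  have hq1 : ∫ x, q x ∂μ = 1 := by
    rw [hq, Measure.integral_toReal_rnDeriv hQ]; simp
  have hpm : Measurable p := (Measure.measurable_rnDeriv P μ).ennreal_toReal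
  have hqm : Measurable q := (Measure.measurable_rnDeriv Q μ).ennreal_toReal
  have hpqi : Integrable (fun x => p x + q x) μ := hpi.add hqi
  have hHi : Integrable (fun x => (√(p x) - √(q x)) ^ 2) μ := by
    refine hpqi.mono' (by fun_prop) (Eventually.of_forall fun x => ?_)
    rw [Real.norm_of_nonneg (sq_nonneg _)]
    nlinarith [Real.sq_sqrt (hp0 x), Real.sq_sqrt (hq0 x),
      mul_nonneg (Real.sqrt_nonneg (p x)) (Real.sqrt_nonneg (q x))]
  have hpt : ∀ x, |p x - q x| ≤ (√(p x) - √(q x)) ^ 2 / t + t * (p x + q x) := by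
    intro x
    have ha := Real.sq_sqrt (hp0 x)
    have hb := Real.sq_sqrt (hq0 x)
    set a := √(p x)
    set b := √(q x)
    rw [← ha, ← hb, abs_le]
    have key : ∀ s : ℝ, s ^ 2 = 1 →
        s * (a ^ 2 - b ^ 2) ≤ (a - b) ^ 2 / t + t * (a ^ 2 + b ^ 2) := by
      intro s hs
      have : (a - b) ^ 2 / t + t * (a ^ 2 + b ^ 2) - s * (a ^ 2 - b ^ 2)
          = (((a - b) - s * t / 2 * (a + b)) ^ 2
            + t ^ 2 * (a ^ 2 + b ^ 2 - s ^ 2 * (a + b) ^ 2 / 4)) / t := by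
        field_simp
        ring
      rw [← sub_nonneg, this, hs]
      have : 0 ≤ a ^ 2 + b ^ 2 - 1 * (a + b) ^ 2 / 4 := by
        nlinarith [sq_nonneg (a - b), sq_nonneg a, sq_nonneg b]
      positivity
    constructor <;> linarith [key 1 (by norm_num), key (-1) (by norm_num)]
  rw [← Measure.setIntegral_toReal_rnDeriv hP, ← Measure.setIntegral_toReal_rnDeriv hQ,
    ← integral_sub hpi.integrableOn hqi.integrableOn]
  calc |∫ x in B, (p x - q x) ∂μ| ≤ ∫ x in B, |p x - q x| ∂μ := abs_integral_le_integral_abs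
    _ ≤ ∫ x, |p x - q x| ∂μ :=
      setIntegral_le_integral (hpi.sub hqi).abs (Eventually.of_forall fun x => abs_nonneg _)
    _ ≤ ∫ x, ((√(p x) - √(q x)) ^ 2 / t + t * (p x + q x)) ∂μ :=
      integral_mono (hpi.sub hqi).abs
        ((hHi.div_const t).add (hpqi.const_mul t)) hpt
    _ = hellingerSq μ P Q / t + t * 2 := by
      rw [integral_add (hHi.div_const t) (hpqi.const_mul t), integral_div,
        integral_const_mul, integral_add hpi hqi, hp1, hq1, one_add_one_eq_two,
        hellingerSq]
    _ ≤ t ^ 2 / t + t * 2 := by gcongr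
    _ = 3 * t := by field_simp; ring

/-- The total variation distance of finite measures, whose supremum runs over all sets, is bounded
by any bound valid on measurable sets. -/
lemma dTV_le_of_measurableSet {𝒳 : Type*} [MeasurableSpace 𝒳] (P Q : Measure 𝒳)
    [IsFiniteMeasure P] [IsFiniteMeasure Q] {c : ℝ}
    (h : ∀ B, MeasurableSet B → |P.real B - Q.real B| ≤ c) : dTV P Q ≤ c := by
  refine ciSup_le fun A => ?_
  have hPA : P (toMeasurable (P + Q) A) = P A := by
    simpa using Measure.measure_toMeasurable_add_inter_left (μ := P) (ν := Q) (t := A)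
      MeasurableSet.univ (measure_ne_top _ _)
  have hQA : Q (toMeasurable (P + Q) A) = Q A := by
    simpa using Measure.measure_toMeasurable_add_inter_right (μ := P) (ν := Q) (t := A)
      MeasurableSet.univ (measure_ne_top _ _)
  rw [← hPA, ← hQA]
  exact h _ (measurableSet_toMeasurable _ _)

/-- If `κ θ` is uniformly close to `R` outside a set of small mass, then so is the mixture. -/
lemma dTV_bind_le {𝒳 Θp : Type*} [MeasurableSpace 𝒳] [MeasurableSpace Θp]
    (Q : Measure Θp) [IsProbabilityMeasure Q] (κ : Θp → Measure 𝒳) (hκ : Measurable κ)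
    (hκ_prob : ∀ θ, IsProbabilityMeasure (κ θ)) (R : Measure 𝒳) [IsProbabilityMeasure R]
    (S : Set Θp) {c : ℝ} (hc : 0 ≤ c) (hS : ∀ θ ∉ S, ∀ B, |(κ θ).real B - R.real B| ≤ c) :
    dTV (Q.bind κ) R ≤ c + Q.real S := by
  have : IsProbabilityMeasure (Q.bind κ) :=
    isProbabilityMeasure_bind hκ.aemeasurable (Eventually.of_forall hκ_prob)
  refine dTV_le_of_measurableSet _ _ fun B hB => ?_
  have hgm : Measurable fun θ => (κ θ).real B :=
    ((Measure.measurable_coe hB).comp hκ).ennreal_toReal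
  have hgi : Integrable (fun θ => (κ θ).real B) Q :=
    Integrable.of_bound hgm.aestronglyMeasurable 1
      (Eventually.of_forall fun θ => by
        rw [Real.norm_of_nonneg measureReal_nonneg]; exact measureReal_le_one)
  have hbind : (Q.bind κ).real B = ∫ θ, (κ θ).real B ∂Q := by
    rw [Measure.real, Measure.bind_apply hB hκ.aemeasurable]
    exact (integral_toReal ((Measure.measurable_coe hB).comp hκ).aemeasurable
      (Eventually.of_forall fun θ => measure_lt_top _ _)).symm
  have hdiff : (Q.bind κ).real B - R.real B = ∫ θ, ((κ θ).real B - R.real B) ∂Q := by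
    rw [integral_sub hgi (integrable_const _), hbind]; simp
  set T := toMeasurable Q S
  have hT : MeasurableSet T := measurableSet_toMeasurable _ _
  have hbound : ∀ θ, |(κ θ).real B - R.real B| ≤ c + T.indicator 1 θ := by
    intro θ
    by_cases hθ : θ ∈ T
    · have h1 : (κ θ).real B ≤ 1 := measureReal_le_one
      have h2 : R.real B ≤ 1 := measureReal_le_one
      have h3 : 0 ≤ (κ θ).real B := measureReal_nonneg
      have h4 : 0 ≤ R.real B := measureReal_nonneg
      rw [Set.indicator_of_mem hθ, Pi.one_apply, abs_le]
      constructor <;> linarith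
    · rw [Set.indicator_of_notMem hθ, add_zero]
      exact hS θ (fun h => hθ (subset_toMeasurable _ _ h)) B
  have hTi : Integrable (T.indicator (1 : Θp → ℝ)) Q := (integrable_const 1).indicator hT
  calc |(Q.bind κ).real B - R.real B| ≤ ∫ θ, |(κ θ).real B - R.real B| ∂Q := by
        rw [hdiff]; exact abs_integral_le_integral_abs
    _ ≤ ∫ θ, (c + T.indicator 1 θ) ∂Q :=
      integral_mono (hgi.sub (integrable_const _)).abs ((integrable_const c).add hTi) hbound
    _ = c + Q.real S := by
      rw [integral_add (integrable_const c) hTi, integral_indicator_one hT]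
      simp [T, Measure.real, measure_toMeasurable]

/-- First claim of the paper's Theorem 2 (merging of the GVP with the optimal
predictive): if, for every `ε > 0`, the variational posterior mass
`Q̂({θ : d_H²(P_θ^{(n)}, P⋆^{(n)}) ≥ ε})` converges to zero in `P₀`-probability, then
`d_TV(P_Q^{(n)}, P⋆^{(n)}) → 0` in `P₀`-probability, where
`P_Q^{(n)} = ∫_Θ P_θ^{(n)} dQ̂(θ)` is the Gibbs variational predictive. -/
theorem gvp_merges_with_optimal_predictive
    (𝒳 : Type*) [MeasurableSpace 𝒳] (μ : Measure 𝒳) [SigmaFinite μ]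
    (Ω : Type*) [MeasurableSpace Ω] (P₀ : Measure Ω) [IsProbabilityMeasure P₀]
    (Θp : Type*) [MeasurableSpace Θp]
    -- the one-step-ahead predictives P_θ^{(n)} (depending on the data)
    (pred : ℕ → Ω → Θp → Measure 𝒳)
    (hpred_prob : ∀ n ω θ, IsProbabilityMeasure (pred n ω θ))
    (hpred_ac : ∀ n ω θ, pred n ω θ ≪ μ)
    (hpred_meas : ∀ n ω, Measurable (pred n ω))
    -- the optimal parameter value θ⋆ (so P⋆^{(n)} = pred n ω θstar)
    (θstar : Θp)
    -- the Gibbs variational posterior Q̂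
    (Qhat : ℕ → Ω → Measure Θp)
    (hQhat_prob : ∀ n ω, IsProbabilityMeasure (Qhat n ω))
    -- concentration of Q̂ in squared Hellinger distance, in P₀-probability
    (hconc : ∀ e > (0 : ℝ), ∀ δ > (0 : ℝ), Tendsto (fun n =>
      P₀ {ω | ENNReal.ofReal δ <
        Qhat n ω {θ | e ≤ hellingerSq μ (pred n ω θ) (pred n ω θstar)}})
      atTop (𝓝 0)) :
    ∀ δ > (0 : ℝ), Tendsto (fun n =>
      P₀ {ω | δ < dTV ((Qhat n ω).bind (pred n ω)) (pred n ω θstar)})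
      atTop (𝓝 0) := by
  intro δ hδ
  have ht : 0 < δ / 6 := by positivity
  refine tendsto_of_tendsto_of_tendsto_of_le_of_le tendsto_const_nhds
    (hconc ((δ / 6) ^ 2) (by positivity) (δ / 2) (by positivity))
    (fun n => zero_le) fun n => measure_mono fun ω hω => ?_
  simp only [Set.mem_ofPred_eq] at hω ⊢
  contrapose! hω
  have := hpred_prob n ω
  have := hQhat_prob n ω
  refine (dTV_bind_le (Qhat n ω) (pred n ω) (hpred_meas n ω) (hpred_prob n ω) _
    {θ | (δ / 6) ^ 2 ≤ hellingerSq μ (pred n ω θ) (pred n ω θstar)}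
    (by positivity : 0 ≤ 3 * (δ / 6)) fun θ hθ B =>
      abs_measureReal_sub_le_of_hellingerSq_le μ _ _ (hpred_ac n ω θ) (hpred_ac n ω θstar) ht
        (not_le.mp hθ).le B).trans ?_
  have := ENNReal.toReal_le_of_le_ofReal (by positivity) hω
  rw [Measure.real]
  linarith
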